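/- arXiv:1501.07069 — 6 statements merged into one kernel-verified Lean document; each statement's English description precedes it below -/
import Mathlib

section
/- In the moment-map setting, define S(w₁,w₂) := trace(w₂★·w₁) for w₁, w₂ ∈ Mat_{n'×n}(k), B(Y,X) := (1/2)·trace((J⁻¹·Xᵀ·J)·Y) for X, Y ∈ Mat_{n×n}(k), and B'(Y',X') := (1/2)·trace((J'⁻¹·X'ᵀ·J')·Y') for X', Y' ∈ Mat_{n'×n'}(k). Then for every w ∈ Mat_{n'×n}(k), every X ∈ Mat_{n×n}(k) with XᵀJ + JX = 0, and every X' ∈ Mat_{n'×n'}(k) with X'ᵀJ' + J'X' = 0: S(−w·X, w) = 2·B(M(w), X) and S(X'·w, w) = −2·B'(M'(w), X'). -/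
open Matrix

/-- The moment maps intertwine the symplectic trace form `S` on
`Hom(V,V')` with the invariant trace forms `B`, `B'` on the Lie algebras:
`S(−w·X, w) = 2·B(M(w),X)` and `S(X'·w, w) = −2·B'(M'(w),X')`, where
`S(w₁,w₂) = tr(w₂★ w₁)`, `B(Y,X) = (1/2)tr((J⁻¹XᵀJ)Y)`,
`B'(Y',X') = (1/2)tr((J'⁻¹X'ᵀJ')Y')`, `w★ = J⁻¹wᵀJ'`, `M(w) = w★w`, `M'(w) = ww★`. -/
theorem stmt_5 (k : Type*) [Field k] (h2 : (2 : k) ≠ 0)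
    (n n' : ℕ) (ε : k) (hε : ε = 1 ∨ ε = -1)
    (J : Matrix (Fin n) (Fin n) k) (hJ : IsUnit J.det) (hJsym : Jᵀ = ε • J)
    (J' : Matrix (Fin n') (Fin n') k) (hJ' : IsUnit J'.det) (hJ'sym : J'ᵀ = (-ε) • J') :
    ∀ (w : Matrix (Fin n') (Fin n) k)
      (X : Matrix (Fin n) (Fin n) k) (X' : Matrix (Fin n') (Fin n') k),
      Xᵀ * J + J * X = 0 → X'ᵀ * J' + J' * X' = 0 →
      (Matrix.trace ((J⁻¹ * wᵀ * J') * (-(w * X))) =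
        2 * ((2 : k)⁻¹ * Matrix.trace ((J⁻¹ * Xᵀ * J) * ((J⁻¹ * wᵀ * J') * w)))) ∧
      (Matrix.trace ((J⁻¹ * wᵀ * J') * (X' * w)) =
        -(2 * ((2 : k)⁻¹ *
          Matrix.trace ((J'⁻¹ * X'ᵀ * J') * (w * (J⁻¹ * wᵀ * J')))))) := by
  intro w X X' hX hX'
  have e1 : J⁻¹ * Xᵀ * J = -X := by
    rw [Matrix.mul_assoc, eq_neg_of_add_eq_zero_left hX, Matrix.mul_neg, ← Matrix.mul_assoc,
      Matrix.nonsing_inv_mul _ hJ, Matrix.one_mul]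
  have e2 : J'⁻¹ * X'ᵀ * J' = -X' := by
    rw [Matrix.mul_assoc, eq_neg_of_add_eq_zero_left hX', Matrix.mul_neg, ← Matrix.mul_assoc,
      Matrix.nonsing_inv_mul _ hJ', Matrix.one_mul]
  rw [e1, e2, mul_inv_cancel_left₀ h2, mul_inv_cancel_left₀ h2]
  generalize J⁻¹ * wᵀ * J' = s
  constructor
  · rw [Matrix.mul_neg, Matrix.neg_mul, Matrix.trace_neg, Matrix.trace_neg,
      ← Matrix.mul_assoc, Matrix.trace_mul_comm]
  · rw [Matrix.neg_mul, Matrix.trace_neg, neg_neg, Matrix.trace_mul_comm, Matrix.mul_assoc]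
end

section
/- Let k be a field of characteristic 0 and n ≥ 1. Set J := [[0, Iₙ],[Iₙ, 0]] ∈ Mat_{2n×2n}(k) and J' := [[0, Iₙ],[−Iₙ, 0]] ∈ Mat_{2n×2n}(k); for w ∈ Mat_{2n×2n}(k) put w★ := J⁻¹·wᵀ·J', M(w) := w★·w and M'(w) := w·w★, and set 𝔰𝔬 := {X : XᵀJ + JX = 0} and 𝔰𝔭 := {X : XᵀJ' + J'X = 0}. Then there exists w ∈ Mat_{2n×2n}(k) such that the coefficient of z^n in the characteristic polynomial of the endomorphism Y ↦ M(w)·Y − Y·M(w) of 𝔰𝔬 is nonzero, and the coefficient of z^n in the characteristic polynomial of the endomorphism Y ↦ M'(w)·Y − Y·M'(w) of 𝔰𝔭 is nonzero. (Both endomorphisms preserve the stated subspaces, since M(w) ∈ 𝔰𝔬 and M'(w) ∈ 𝔰𝔭.) -/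
open Matrix Polynomial

/-- The Lie algebra `𝔲(J) = {X | XᵀJ + JX = 0}` as a submodule of matrices. -/
def uSub (k : Type*) [Field k] {m : Type*} [Fintype m]
    (J : Matrix m m k) : Submodule k (Matrix m m k) where
  carrier := {X | Xᵀ * J + J * X = 0}
  zero_mem' := by simp
  add_mem' := by
    intro a b ha hb
    simp only [Set.mem_setOf_eq] at ha hb ⊢
    rw [Matrix.transpose_add, Matrix.add_mul, Matrix.mul_add]
    calc aᵀ * J + bᵀ * J + (J * a + J * b)
        = (aᵀ * J + J * a) + (bᵀ * J + J * b) := by abel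
      _ = 0 := by rw [ha, hb, add_zero]
  smul_mem' := by
    intro c X hX
    simp only [Set.mem_setOf_eq] at hX ⊢
    rw [Matrix.transpose_smul, Matrix.smul_mul, Matrix.mul_smul, ← smul_add, hX,
      smul_zero]

/-- The adjoint action `ad A : Y ↦ A·Y − Y·A` as a linear endomorphism of matrices. -/
noncomputable def adMat (k : Type*) [Field k] {m : Type*} [Fintype m]
    (A : Matrix m m k) : Matrix m m k →ₗ[k] Matrix m m k :=
  LinearMap.mulLeft k A - LinearMap.mulRight k A

/-- `J = [[0,Iₙ],[Iₙ,0]]`, the symmetric form of `O(2n)`. -/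
def JO (k : Type*) [Field k] (n : ℕ) : Matrix (Fin n ⊕ Fin n) (Fin n ⊕ Fin n) k :=
  Matrix.fromBlocks 0 1 1 0

/-- `J' = [[0,Iₙ],[−Iₙ,0]]`, the symplectic form of `Sp(2n)`. -/
def JSp (k : Type*) [Field k] (n : ℕ) : Matrix (Fin n ⊕ Fin n) (Fin n ⊕ Fin n) k :=
  Matrix.fromBlocks 0 1 (-1) 0

lemma aux_ad_apply (k : Type*) [Field k] {m : Type*} [Fintype m] [DecidableEq m] (e : m → k)
    (Y : Matrix m m k) (i j : m) :
    adMat k (Matrix.diagonal e) Y i j = (e i - e j) * Y i j := by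
  simp [adMat, Matrix.diagonal_mul, Matrix.mul_diagonal]
  ring

lemma aux_mem (k : Type*) [Field k] {n : ℕ} (a : Fin n → k) (c : k) :
    Matrix.diagonal (Sum.elim a (-a)) ∈
      uSub k (Matrix.fromBlocks 0 1 (c • 1) 0 : Matrix (Fin n ⊕ Fin n) (Fin n ⊕ Fin n) k) := by
  change _ᵀ * _ + _ * _ = _
  rw [← Matrix.fromBlocks_diagonal]
  simp only [Matrix.fromBlocks_transpose, Matrix.fromBlocks_multiply, Matrix.fromBlocks_add]
  rw [← Matrix.fromBlocks_zero]
  congr 1 <;> ext i j <;> by_cases h : i = j <;> simp [h, Matrix.diagonal_apply]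

lemma aux_pres (k : Type*) [Field k] {m : Type*} [Fintype m] (J A : Matrix m m k)
    (hA : A ∈ uSub k J) : ∀ Y ∈ uSub k J, adMat k A Y ∈ uSub k J := by
  intro Y hY
  change Aᵀ * J + J * A = 0 at hA
  change Yᵀ * J + J * Y = 0 at hY
  change (A * Y - Y * A)ᵀ * J + J * (A * Y - Y * A) = 0
  have h1 : Aᵀ * J = - (J * A) := eq_neg_of_add_eq_zero_left hA
  have h2 : Yᵀ * J = - (J * Y) := eq_neg_of_add_eq_zero_left hY
  simp only [Matrix.transpose_sub, Matrix.transpose_mul, Matrix.sub_mul, Matrix.mul_sub,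
    Matrix.mul_assoc, h1, h2, Matrix.mul_neg]
  simp only [← Matrix.mul_assoc, h1, h2, Matrix.neg_mul]
  abel

lemma aux_gen {k V : Type*} [Field k] [AddCommGroup V] [Module k V] (f : Module.End k V) (v : V) :
    v ∈ Module.End.maxGenEigenspace f 0 ↔ ∃ r : ℕ, (f ^ r) v = 0 := by
  have h0 : f - (0 : k) • (1 : Module.End k V) = f := by rw [zero_smul, sub_zero]
  rw [Module.End.mem_maxGenEigenspace, h0]

lemma aux_main (k : Type*) [Field k] {n : ℕ} (d : Fin n → k) (c : k)
    (hinj : Function.Injective (Sum.elim d (-d)))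
    (h : ∀ Y ∈ uSub k (Matrix.fromBlocks 0 1 (c • 1) 0 :
        Matrix (Fin n ⊕ Fin n) (Fin n ⊕ Fin n) k),
      adMat k (Matrix.diagonal (Sum.elim d (-d))) Y ∈ uSub k (Matrix.fromBlocks 0 1 (c • 1) 0 :
        Matrix (Fin n ⊕ Fin n) (Fin n ⊕ Fin n) k)) :
    ((adMat k (Matrix.diagonal (Sum.elim d (-d)))).restrict h).charpoly.coeff n ≠ 0 := by
  set f : Module.End k (uSub k (Matrix.fromBlocks 0 1 (c • 1) 0 :
        Matrix (Fin n ⊕ Fin n) (Fin n ⊕ Fin n) k)) := (adMat k (Matrix.diagonal (Sum.elim d (-d)))).restrict h with hf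
  have hpow : ∀ (r : ℕ) (Y) (i j), ((f ^ r) Y).1 i j =
      (Sum.elim d (-d) i - Sum.elim d (-d) j) ^ r * Y.1 i j := by
    intro r
    induction r with
    | zero => intro Y i j; simp
    | succ r ih =>
      intro Y i j
      rw [pow_succ', Module.End.mul_apply]
      change adMat k (Matrix.diagonal (Sum.elim d (-d))) ((f ^ r) Y).1 i j = _
      rw [aux_ad_apply, ih]; ring
  let g : (Fin n → k) →ₗ[k] uSub k (Matrix.fromBlocks 0 1 (c • 1) 0 :
        Matrix (Fin n ⊕ Fin n) (Fin n ⊕ Fin n) k) :=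
    { toFun := fun a => ⟨Matrix.diagonal (Sum.elim a (-a)), aux_mem k a c⟩
      map_add' := by
        intro a b
        apply Subtype.ext
        ext i j
        rcases i with i | i <;> rcases j with j | j <;> by_cases hij : i = j <;>
          simp [hij, Matrix.diagonal_apply, add_comm]
      map_smul' := by
        intro a b
        apply Subtype.ext
        ext i j
        rcases i with i | i <;> rcases j with j | j <;> by_cases hij : i = j <;>
          simp [hij, Matrix.diagonal_apply] }
  have hg : ∀ a, (g a).1 = Matrix.diagonal (Sum.elim a (-a)) := fun a => rfl
  have hginj : Function.Injective g := by
    intro a b hab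
    have h1 := congrArg Subtype.val hab
    rw [hg, hg] at h1
    funext i
    simpa using congrFun (congrFun h1 (Sum.inl i)) (Sum.inl i)
  have hrange : LinearMap.range g = Module.End.maxGenEigenspace f 0 := by
    ext Y
    rw [aux_gen]
    constructor
    · rintro ⟨a, rfl⟩
      refine ⟨1, Subtype.ext ?_⟩
      ext i j
      rw [hpow, hg]
      by_cases hij : i = j <;> simp [hij]
    · rintro ⟨r, hr⟩
      have hoff : ∀ i j, i ≠ j → Y.1 i j = 0 := by
        intro i j hij
        have := hpow r Y i j
        rw [hr] at this
        have h2 : (Sum.elim d (-d) i - Sum.elim d (-d) j) ^ r ≠ 0 :=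
          pow_ne_zero _ (sub_ne_zero.2 (hinj.ne hij))
        exact (mul_eq_zero.1 this.symm).resolve_left h2
      refine ⟨fun i => Y.1 (Sum.inl i) (Sum.inl i), Subtype.ext ?_⟩
      have hY : Y.1ᵀ * _ + _ * Y.1 = 0 := Y.2
      rw [hg]
      ext i j
      by_cases hij : i = j
      · subst hij
        rcases i with i | i
        · simp
        · have h3 := congrFun (congrFun hY (Sum.inl i)) (Sum.inr i)
          simp [Matrix.mul_apply, Matrix.one_apply] at h3
          simp
          linear_combination -h3
      · rw [hoff i j hij, Matrix.diagonal_apply_ne _ hij]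
  have hfin : Module.finrank k (Module.End.maxGenEigenspace f 0) = n := by
    rw [← hrange, LinearMap.finrank_range_of_inj hginj]; simp
  rw [LinearMap.finrank_maxGenEigenspace_zero_eq] at hfin
  have := Polynomial.trailingCoeff_nonzero_iff_nonzero.2 (LinearMap.charpoly_monic f).ne_zero
  rwa [Polynomial.trailingCoeff, hfin] at this

/-- For the dual pair `(O(2n), Sp(2n))` there is a `w` whose moment-map
images `M(w) = w★w ∈ 𝔰𝔬(2n)` and `M'(w) = ww★ ∈ 𝔰𝔭(2n)` are both regular semisimple,
i.e. the coefficient of `zⁿ` in the characteristic polynomial of `ad M(w)` on `𝔰𝔬`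
(resp. of `ad M'(w)` on `𝔰𝔭`) is nonzero. Here `w★ = J⁻¹wᵀJ'`. -/
theorem stmt_9 (k : Type*) [Field k] [CharZero k] (n : ℕ) (hn : 1 ≤ n) :
    ∃ w : Matrix (Fin n ⊕ Fin n) (Fin n ⊕ Fin n) k,
      ∃ (hM : ∀ Y ∈ uSub k (JO k n),
            adMat k (((JO k n)⁻¹ * wᵀ * JSp k n) * w) Y ∈ uSub k (JO k n))
        (hM' : ∀ Y ∈ uSub k (JSp k n),
            adMat k (w * ((JO k n)⁻¹ * wᵀ * JSp k n)) Y ∈ uSub k (JSp k n)),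
        ((adMat k (((JO k n)⁻¹ * wᵀ * JSp k n) * w)).restrict hM).charpoly.coeff n ≠ 0 ∧
        ((adMat k (w * ((JO k n)⁻¹ * wᵀ * JSp k n))).restrict hM').charpoly.coeff n ≠ 0 := by
  let d : Fin n → k := fun i => ((i : ℕ) : k) + 1
  have hinj : Function.Injective (Sum.elim d (-d)) := by
    have hpos : ∀ i j : Fin n, d i ≠ - d j := by
      intro i j hij
      have h0 : (((i : ℕ) + 1 + ((j : ℕ) + 1) : ℕ) : k) = 0 := by
        push_cast
        simp only [d] at hij
        rw [hij]; ring
      rw [Nat.cast_eq_zero] at h0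
      omega
    have hd : Function.Injective d := by
      intro i j hij
      simpa [d, Fin.ext_iff] using hij
    rintro (i | i) (j | j) hij
    · exact congrArg _ (hd hij)
    · exact absurd hij (hpos i j)
    · exact absurd hij.symm (hpos j i)
    · exact congrArg _ (hd (neg_injective hij))
  have hinv : (JO k n)⁻¹ = JO k n := by
    apply Matrix.inv_eq_left_inv
    simp [JO, Matrix.fromBlocks_multiply]
  have hO : JO k n = Matrix.fromBlocks 0 1 ((1 : k) • 1) 0 := by simp [JO]
  have hS : JSp k n = Matrix.fromBlocks 0 1 ((-1 : k) • 1) 0 := by simp [JSp]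
  refine ⟨Matrix.fromBlocks 1 0 0 (-Matrix.diagonal d), ?_⟩
  have e1 : ((JO k n)⁻¹ * (Matrix.fromBlocks 1 0 0 (-Matrix.diagonal d))ᵀ * JSp k n)
      * Matrix.fromBlocks 1 0 0 (-Matrix.diagonal d) = Matrix.diagonal (Sum.elim d (-d)) := by
    rw [hinv, ← Matrix.fromBlocks_diagonal]
    simp [JO, JSp, Matrix.fromBlocks_transpose, Matrix.fromBlocks_multiply]
  have e2 : Matrix.fromBlocks 1 0 0 (-Matrix.diagonal d) *
      ((JO k n)⁻¹ * (Matrix.fromBlocks 1 0 0 (-Matrix.diagonal d))ᵀ * JSp k n)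
       = Matrix.diagonal (Sum.elim d (-d)) := by
    rw [hinv, ← Matrix.fromBlocks_diagonal]
    simp [JO, JSp, Matrix.fromBlocks_transpose, Matrix.fromBlocks_multiply]
  rw [e1, e2, hO, hS]
  exact ⟨aux_pres k _ _ (aux_mem k d _), aux_pres k _ _ (aux_mem k d _),
    aux_main k d _ hinj _, aux_main k d _ hinj _⟩
end

section
/- Let k be a field of characteristic 0 and n ≥ 1. For (x, y) ∈ Mat_{n×n}(k) × Mat_{n×n}(k), set M(x,y) := x·yᵀ and M'(x,y) := yᵀ·x. Then there exists (x, y) such that the coefficient of z^n in the characteristic polynomial of the endomorphism Y ↦ M(x,y)·Y − Y·M(x,y) of Mat_{n×n}(k) is nonzero, and the coefficient of z^n in the characteristic polynomial of Y ↦ M'(x,y)·Y − Y·M'(x,y) of Mat_{n×n}(k) is nonzero. -/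
open Matrix Polynomial

lemma adMat_diagonal_coeff (k : Type*) [Field k] (n : ℕ) (d : Fin n → k)
    (hd : Function.Injective d) : (adMat k (diagonal d)).charpoly.coeff n ≠ 0 := by
  have h1 : LinearMap.toMatrix (Matrix.stdBasis k (Fin n) (Fin n))
      (Matrix.stdBasis k (Fin n) (Fin n)) (adMat k (diagonal d))
      = diagonal (fun p : Fin n × Fin n => d p.1 - d p.2) := by
    rw [← LinearEquiv.eq_symm_apply, LinearMap.toMatrix_symm]
    refine (Matrix.stdBasis k (Fin n) (Fin n)).ext fun p => ?_
    rw [Matrix.toLin_self]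
    obtain ⟨a, b⟩ := p
    rw [Finset.sum_eq_single (a, b)]
    · ext i j
      simp only [adMat, LinearMap.sub_apply, LinearMap.mulLeft_apply, LinearMap.mulRight_apply,
        Matrix.stdBasis_eq_single, Matrix.sub_apply, Matrix.diagonal_mul, Matrix.mul_diagonal,
        Matrix.diagonal_apply_eq, Matrix.smul_apply, Matrix.single_apply, smul_eq_mul]
      split_ifs with h
      · rw [h.1, h.2]; ring
      · ring
    · intro q _ hq
      rw [Matrix.diagonal_apply_ne _ hq, zero_smul]
    · simp
  rw [← LinearMap.charpoly_toMatrix _ (Matrix.stdBasis k (Fin n) (Fin n)), h1,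
    Matrix.charpoly_diagonal,
    ← Finset.prod_filter_mul_prod_filter_not Finset.univ (fun p : Fin n × Fin n => p.1 = p.2)]
  have h2 : ∏ p : Fin n × Fin n with p.1 = p.2, (X - C (d p.1 - d p.2)) = (X : k[X]) ^ n := by
    rw [Finset.prod_congr rfl (g := fun _ => (X : k[X]))]
    · rw [Finset.prod_const]
      congr 1
      have := Finset.diag_card (Finset.univ : Finset (Fin n))
      rw [Finset.card_univ, Fintype.card_fin] at this
      refine Eq.trans (congrArg Finset.card ?_) this
      ext p
      simp [Finset.mem_diag]
    · intro p hp
      rw [(Finset.mem_filter.mp hp).2]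
      simp
  rw [h2, Polynomial.coeff_X_pow_mul', if_pos le_rfl, Nat.sub_self,
    Polynomial.coeff_zero_eq_eval_zero, Polynomial.eval_prod, Finset.prod_ne_zero_iff]
  intro p hp
  have hp2 := (Finset.mem_filter.mp hp).2
  simp only [eval_sub, eval_X, eval_C, zero_sub, neg_ne_zero, sub_ne_zero]
  exact fun h => hp2 (hd h)

/-- For the dual pair `(GL(n), GL(n))` there is a pair
`(x,y) ∈ Mat_{n×n} × Mat_{n×n}` such that both moment-map images `M(x,y) = x·yᵀ`
and `M'(x,y) = yᵀ·x` are regular semisimple in `𝔤𝔩(n)`, i.e. the coefficient of `zⁿ`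
in the characteristic polynomial of `ad M(x,y)` (resp. `ad M'(x,y)`) on
`Mat_{n×n}(k)` is nonzero. -/
theorem stmt_12 (k : Type*) [Field k] [CharZero k] (n : ℕ) (hn : 1 ≤ n) :
    ∃ x y : Matrix (Fin n) (Fin n) k,
      (adMat k (x * yᵀ)).charpoly.coeff n ≠ 0 ∧
      (adMat k (yᵀ * x)).charpoly.coeff n ≠ 0 := by
  have hd : Function.Injective (fun i : Fin n => ((i : ℕ) : k)) := fun i j h =>
    Fin.ext (Nat.cast_injective h)
  refine ⟨diagonal (fun i : Fin n => ((i : ℕ) : k)), 1, ?_, ?_⟩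
  · rw [Matrix.transpose_one, Matrix.mul_one]
    exact adMat_diagonal_coeff k n _ hd
  · rw [Matrix.transpose_one, Matrix.one_mul]
    exact adMat_diagonal_coeff k n _ hd
end

section
/- Let k be a field of characteristic 0 and n ≥ 1. For (x, y) ∈ Mat_{n×(n+1)}(k) × Mat_{n×(n+1)}(k), set M(x,y) := x·yᵀ ∈ Mat_{n×n}(k) and M'(x,y) := yᵀ·x ∈ Mat_{(n+1)×(n+1)}(k). Then there exists (x, y) such that the coefficient of z^n in the characteristic polynomial of the endomorphism Y ↦ M(x,y)·Y − Y·M(x,y) of Mat_{n×n}(k) is nonzero, and the coefficient of z^{n+1} in the characteristic polynomial of Y ↦ M'(x,y)·Y − Y·M'(x,y) of Mat_{(n+1)×(n+1)}(k) is nonzero. -/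
open Matrix Polynomial

lemma adMat_diag_coeff (k : Type*) [Field k] {m : Type*} [Fintype m] [DecidableEq m]
    (d : m → k) (hd : Function.Injective d) (N : ℕ) (hN : Fintype.card m = N) :
    (adMat k (Matrix.diagonal d)).charpoly.coeff N ≠ 0 := by
  have h : LinearMap.toMatrix (Matrix.stdBasis k m m) (Matrix.stdBasis k m m)
      (adMat k (Matrix.diagonal d)) = Matrix.diagonal (fun p : m × m => d p.1 - d p.2) := by
    ext ⟨a, b⟩ ⟨i, j⟩
    rw [LinearMap.toMatrix_apply, Matrix.stdBasis_eq_single]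
    have : (adMat k (Matrix.diagonal d)) (Matrix.single i j 1)
        = (d i - d j) • Matrix.stdBasis k m m (i, j) := by
      rw [Matrix.stdBasis_eq_single]
      ext a b
      simp only [adMat, LinearMap.sub_apply, LinearMap.mulLeft_apply, LinearMap.mulRight_apply,
        Matrix.sub_apply, Matrix.diagonal_mul, Matrix.mul_diagonal, Matrix.smul_apply,
        Matrix.single_apply, smul_eq_mul]
      split_ifs with h
      · obtain ⟨rfl, rfl⟩ := h
        ring
      · simp
    rw [this, map_smul, Module.Basis.repr_self, Finsupp.smul_single, Matrix.diagonal_apply,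
      Finsupp.single_apply]
    by_cases h : (i, j) = (a, b)
    · rw [if_pos h, if_pos h.symm]
      cases h
      simp
    · rw [if_neg h, if_neg (fun h' => h h'.symm)]
  rw [← LinearMap.charpoly_toMatrix _ (Matrix.stdBasis k m m), h, Matrix.charpoly_diagonal,
    ← Finset.prod_filter_mul_prod_filter_not Finset.univ (fun p : m × m => p.1 = p.2)]
  have h1 : ∏ p ∈ Finset.univ.filter (fun p : m × m => p.1 = p.2),
      ((X : k[X]) - C (d p.1 - d p.2)) = X ^ N := by
    rw [Finset.prod_congr rfl (g := fun _ => (X : k[X])), Finset.prod_const]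
    · congr 1
      rw [← hN, ← Finset.card_univ, ← Finset.diag_card (Finset.univ : Finset m)]
      congr 1
      ext ⟨a, b⟩
      simp
    · intro p hp
      simp [(Finset.mem_filter.1 hp).2]
  rw [h1, Polynomial.coeff_X_pow_mul', if_pos le_rfl, Nat.sub_self,
    Polynomial.coeff_zero_eq_eval_zero, Polynomial.eval_prod, Finset.prod_ne_zero_iff]
  intro p hp
  have hp2 := (Finset.mem_filter.1 hp).2
  simp only [eval_sub, eval_X, eval_C, zero_sub, neg_ne_zero, sub_ne_zero]
  exact fun h' => hp2 (hd h')

theorem stmt_13 (k : Type*) [Field k] [CharZero k] (n : ℕ) (hn : 1 ≤ n) :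
    ∃ x y : Matrix (Fin n) (Fin (n+1)) k,
      (adMat k (x * yᵀ)).charpoly.coeff n ≠ 0 ∧
      (adMat k (yᵀ * x)).charpoly.coeff (n+1) ≠ 0 := by
  refine ⟨Matrix.of fun i j => if j = i.succ then ((j : ℕ) : k) else 0,
    Matrix.of fun i j => if j = i.succ then 1 else 0, ?_, ?_⟩
  · convert adMat_diag_coeff k (fun i : Fin n => ((i.succ : ℕ) : k)) ?_ n (by simp) using 4
    · ext i j
      simp only [Matrix.mul_apply, Matrix.diagonal_apply, Matrix.transpose_apply, Matrix.of_apply]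
      rw [Finset.sum_eq_single i.succ]
      · by_cases h : i = j
        · simp [h]
        · simp [h]
      · intro b _ hb
        simp [hb]
      · simp
    · intro a b h
      have h := Nat.cast_injective h
      exact Fin.succ_injective _ (Fin.ext h)
  · convert adMat_diag_coeff k (fun i : Fin (n+1) => ((i : ℕ) : k)) ?_ (n+1) (by simp) using 4
    · ext i j
      rw [Matrix.mul_apply, Matrix.diagonal_apply]
      simp only [Matrix.transpose_apply, Matrix.of_apply]
      cases i using Fin.cases with
      | zero => simp [(Fin.succ_ne_zero _).symm]
      | succ i =>
        rw [Finset.sum_eq_single i]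
        · by_cases h : j = i.succ
          · simp [h]
          · simp [h, Ne.symm h]
        · intro b _ hb
          simp [Ne.symm hb]
        · simp
    · intro a b h
      exact Fin.ext (Nat.cast_injective h)
end

section
/- Let k be a field with char k ≠ 2, n ≥ 1, a : {1,…,n} → k. Set J := [[0, Iₙ],[−Iₙ, 0]] ∈ Mat_{2n×2n}(k), 𝔰𝔭 := {Y ∈ Mat_{2n×2n}(k) : YᵀJ + JY = 0}, and X := diag(a₁, …, aₙ, −a₁, …, −aₙ). Then X ∈ 𝔰𝔭, the map Y ↦ X·Y − Y·X preserves 𝔰𝔭, and its characteristic polynomial as an endomorphism of 𝔰𝔭 equals z^n · ∏_{1 ≤ i < j ≤ n} (z² − (a_i − a_j)²)·(z² − (a_i + a_j)²) · ∏_{i=1}^{n} (z² − 4·a_i²). -/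
open Matrix Polynomial

namespace SpAux

theorem mem_iff (k : Type*) [Field k] (n : ℕ) (Y : Matrix (Fin n ⊕ Fin n) (Fin n ⊕ Fin n) k) :
    Y ∈ uSub k (JSp k n) ↔
      (∀ i j, Y (.inr i) (.inr j) = - Y (.inl j) (.inl i)) ∧
      (∀ i j, Y (.inl i) (.inr j) = Y (.inl j) (.inr i)) ∧
      (∀ i j, Y (.inr i) (.inl j) = Y (.inr j) (.inl i)) := by
  change Yᵀ * JSp k n + JSp k n * Y = 0 ↔ _
  obtain ⟨A, B, C, D, rfl⟩ : ∃ A B C D, Y = Matrix.fromBlocks A B C D :=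
    ⟨_, _, _, _, (Matrix.fromBlocks_toBlocks Y).symm⟩
  rw [JSp, Matrix.fromBlocks_transpose, Matrix.fromBlocks_multiply, Matrix.fromBlocks_multiply,
    Matrix.fromBlocks_add, ← Matrix.fromBlocks_zero, Matrix.fromBlocks_inj]
  simp only [← Matrix.ext_iff]
  simp
  constructor
  · rintro ⟨h1, h2, h3, h4⟩
    refine ⟨fun i j => ?_, fun i j => ?_, fun i j => ?_⟩
    · linear_combination h2 i j
    · linear_combination -h4 i j
    · linear_combination h1 i j
  · rintro ⟨h1, h2, h3⟩
    refine ⟨fun i j => ?_, fun i j => ?_, fun i j => ?_, fun i j => ?_⟩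
    · linear_combination h3 i j
    · linear_combination h1 i j
    · linear_combination -h1 j i
    · linear_combination -h2 i j

/-- Pairs `i ≤ j`. -/
abbrev S (n : ℕ) := {p : Fin n × Fin n // p.1 ≤ p.2}

/-- Index set of the coordinates on `𝔰𝔭(2n)`. -/
abbrev Idx (n : ℕ) := (Fin n × Fin n) ⊕ (S n ⊕ S n)

/-- The position of the matrix entry for a coordinate. -/
def pos (n : ℕ) : Idx n → (Fin n ⊕ Fin n) × (Fin n ⊕ Fin n)
  | .inl p => (.inl p.1, .inl p.2)
  | .inr (.inl p) => (.inl p.1.1, .inr p.1.2)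
  | .inr (.inr p) => (.inr p.1.1, .inl p.1.2)

/-- The matrix with given coordinates. -/
def mk (k : Type*) [Field k] (n : ℕ) (v : Idx n → k) :
    Matrix (Fin n ⊕ Fin n) (Fin n ⊕ Fin n) k :=
  Matrix.of fun x y => match x, y with
  | .inl i, .inl j => v (.inl (i, j))
  | .inr i, .inr j => - v (.inl (j, i))
  | .inl i, .inr j => v (.inr (.inl ⟨(min i j, max i j), min_le_max⟩))
  | .inr i, .inl j => v (.inr (.inr ⟨(min i j, max i j), min_le_max⟩))

theorem mk_mem (k : Type*) [Field k] (n : ℕ) (v : Idx n → k) : mk k n v ∈ uSub k (JSp k n) := by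
  rw [mem_iff]
  refine ⟨fun i j => rfl, fun i j => ?_, fun i j => ?_⟩
  · simp only [mk, Matrix.of_apply, min_comm i j, max_comm i j]
  · simp only [mk, Matrix.of_apply, min_comm i j, max_comm i j]

/-- Coordinates on `𝔰𝔭(2n)`. -/
def coords (k : Type*) [Field k] (n : ℕ) : uSub k (JSp k n) ≃ₗ[k] (Idx n → k) where
  toFun Y := fun x => Y.1 (pos n x).1 (pos n x).2
  map_add' _ _ := rfl
  map_smul' _ _ := rfl
  invFun v := ⟨mk k n v, mk_mem k n v⟩
  left_inv := by
    rintro ⟨Y, hY⟩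
    obtain ⟨h1, h2, h3⟩ := (mem_iff k n Y).1 hY
    apply Subtype.ext
    ext x y
    rcases x with i | i <;> rcases y with j | j
    · rfl
    · rcases le_total i j with h | h
      · simp [mk, pos, h]
      · simp [mk, pos, h, h2 i j]
    · rcases le_total i j with h | h
      · simp [mk, pos, h]
      · simp [mk, pos, h, h3 i j]
    · exact (h1 i j).symm
  right_inv := by
    intro v
    ext x
    rcases x with p | p | p
    · rfl
    · obtain ⟨⟨i, j⟩, h⟩ := p
      have h' : i ≤ j := h
      simp [mk, pos, h']
    · obtain ⟨⟨i, j⟩, h⟩ := p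
      have h' : i ≤ j := h
      simp [mk, pos, h']

theorem ad_apply (k : Type*) [Field k] {m : Type*} [Fintype m] [DecidableEq m] (d : m → k)
    (Y : Matrix m m k) (x y : m) :
    adMat k (Matrix.diagonal d) Y x y = (d x - d y) * Y x y := by
  simp [adMat, Matrix.diagonal_mul, Matrix.mul_diagonal]
  ring

theorem prod_le {M : Type*} [CommMonoid M] (n : ℕ) (g : Fin n × Fin n → M) :
    ∏ p : S n, g p.1 = (∏ p ∈ Finset.univ.filter (fun p : Fin n × Fin n => p.1 < p.2), g p) *
      ∏ i : Fin n, g (i, i) := by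
  rw [← Finset.prod_subtype (Finset.univ.filter (fun p : Fin n × Fin n => p.1 ≤ p.2))
    (by simp) g]
  rw [← Finset.prod_filter_mul_prod_filter_not _ (fun p : Fin n × Fin n => p.1 < p.2)]
  congr 1
  · apply Finset.prod_congr _ (fun _ _ => rfl)
    ext p
    simp only [Finset.mem_filter, Finset.mem_univ, true_and]
    exact ⟨fun h => h.2, fun h => ⟨h.le, h⟩⟩
  · symm
    apply Finset.prod_bij (fun i _ => (i, i))
    · simp
    · simp
    · rintro ⟨i, j⟩ h
      simp at h
      exact ⟨i, by simp, by rw [le_antisymm h.1 h.2]⟩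
    · simp

theorem prod_all {M : Type*} [CommMonoid M] (n : ℕ) (g : Fin n × Fin n → M) :
    ∏ p, g p = (∏ p ∈ Finset.univ.filter (fun p : Fin n × Fin n => p.1 < p.2),
      (g p * g (p.2, p.1))) * ∏ i : Fin n, g (i, i) := by
  rw [← Finset.prod_filter_mul_prod_filter_not _ (fun p : Fin n × Fin n => p.1 ≤ p.2),
    Finset.prod_subtype (Finset.univ.filter (fun p : Fin n × Fin n => p.1 ≤ p.2))
    (p := fun p : Fin n × Fin n => p.1 ≤ p.2) (by simp) g, prod_le, Finset.prod_mul_distrib,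
    mul_right_comm]
  congr 2
  symm
  apply Finset.prod_bij (fun p _ => (p.2, p.1))
  · simp
  · rintro ⟨i, j⟩ _ ⟨i', j'⟩ _ h
    simp at h
    simp [h]
  · rintro ⟨i, j⟩ h
    simp at h
    exact ⟨(j, i), by simpa using h, rfl⟩
  · simp

end SpAux

/-- For `D = diag(a₁,…,aₙ,−a₁,…,−aₙ) ∈ 𝔰𝔭(2n)`, the map `ad D` preserves
`𝔰𝔭(2n)` and its characteristic polynomial on `𝔰𝔭(2n)` equals
`zⁿ·∏_{i<j}(z²−(aᵢ−aⱼ)²)(z²−(aᵢ+aⱼ)²)·∏ᵢ(z²−4aᵢ²)`. -/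
theorem stmt_15 (k : Type*) [Field k] (h2 : (2 : k) ≠ 0) (n : ℕ) (hn : 1 ≤ n)
    (a : Fin n → k) :
    Matrix.diagonal (Sum.elim a (fun i => -a i)) ∈ uSub k (JSp k n) ∧
    ∃ h : ∀ Y ∈ uSub k (JSp k n),
        adMat k (Matrix.diagonal (Sum.elim a (fun i => -a i))) Y ∈ uSub k (JSp k n),
      ((adMat k (Matrix.diagonal (Sum.elim a (fun i => -a i)))).restrict h).charpoly =
        X ^ n *
          (∏ p ∈ Finset.univ.filter (fun p : Fin n × Fin n => p.1 < p.2),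
            ((X ^ 2 - C ((a p.1 - a p.2) ^ 2)) * (X ^ 2 - C ((a p.1 + a p.2) ^ 2)))) *
          ∏ i : Fin n, (X ^ 2 - C (4 * a i ^ 2)) := by
  have had := SpAux.ad_apply k (Sum.elim a (fun i => -a i))
  have h : ∀ Y ∈ uSub k (JSp k n),
      adMat k (Matrix.diagonal (Sum.elim a (fun i => -a i))) Y ∈ uSub k (JSp k n) := by
    intro Y hY
    rw [SpAux.mem_iff] at hY ⊢
    obtain ⟨h1, h2, h3⟩ := hY
    simp only [had, Sum.elim_inl, Sum.elim_inr]
    refine ⟨fun i j => ?_, fun i j => ?_, fun i j => ?_⟩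
    · rw [h1 i j]; ring
    · rw [h2 i j]; ring
    · rw [h3 i j]; ring
  refine ⟨?_, h, ?_⟩
  · rw [SpAux.mem_iff]
    refine ⟨fun i j => ?_, fun i j => ?_, fun i j => ?_⟩
    · by_cases hij : i = j
      · subst hij; simp
      · simp [Matrix.diagonal_apply, hij, Ne.symm hij]
    · simp [Matrix.diagonal_apply]
    · simp [Matrix.diagonal_apply]
  · have key : (SpAux.coords k n).conj
        ((adMat k (Matrix.diagonal (Sum.elim a (fun i => -a i)))).restrict h) =
        Matrix.toLin' (Matrix.diagonal (fun x : SpAux.Idx n =>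
          Sum.elim a (fun i => -a i) (SpAux.pos n x).1 -
            Sum.elim a (fun i => -a i) (SpAux.pos n x).2)) := by
      refine LinearMap.ext fun v => funext fun x => ?_
      obtain ⟨Y, rfl⟩ := (SpAux.coords k n).surjective v
      rw [LinearEquiv.conj_apply_apply, LinearEquiv.symm_apply_apply, Matrix.toLin'_apply,
        Matrix.mulVec_diagonal]
      exact had Y.1 _ _
    rw [← LinearEquiv.charpoly_conj (SpAux.coords k n), key, Matrix.charpoly_toLin',
      Matrix.charpoly_diagonal, Fintype.prod_sum_type, Fintype.prod_sum_type]
    simp only [SpAux.pos, Sum.elim_inl, Sum.elim_inr]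
    rw [SpAux.prod_all n (fun p => X - C (a p.1 - a p.2)),
      SpAux.prod_le n (fun p => X - C (a p.1 - -a p.2)),
      SpAux.prod_le n (fun p => X - C (-a p.1 - a p.2))]
    have e1 : ∏ i : Fin n, (X - C (a i - a i)) = (X : k[X]) ^ n := by simp
    have e2 : ∏ i : Fin n, (X ^ 2 - C (4 * a i ^ 2)) =
        (∏ i : Fin n, (X - C (a i - -a i))) * ∏ i : Fin n, (X - C (-a i - a i)) := by
      rw [← Finset.prod_mul_distrib]
      refine Finset.prod_congr rfl fun i _ => ?_
      have : (C (4 : k)) = 4 := rfl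
      simp only [map_sub, map_neg, map_mul, map_pow, this]
      ring
    have e3 : ∀ p : Fin n × Fin n,
        ((X ^ 2 - C ((a p.1 - a p.2) ^ 2)) * (X ^ 2 - C ((a p.1 + a p.2) ^ 2)) : k[X]) =
        ((X - C (a p.1 - a p.2)) * (X - C (a p.2 - a p.1))) *
          (X - C (a p.1 - -a p.2)) * (X - C (-a p.1 - a p.2)) := by
      intro p
      simp only [map_sub, map_neg, map_add, map_pow]
      ring
    rw [e2, Finset.prod_congr rfl (fun p _ => e3 p)]
    simp only [Finset.prod_mul_distrib, e1]
    ring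
end

section
/- Let F be a field with char F ≠ 2, let W be an F-vector space with an alternating bilinear form ⟨·,·⟩, and let ψ : (F, +) → ℂˣ be a group homomorphism. Let A be an additive subgroup of W and f : W → ℂ a function satisfying f(a + w) = ψ((1/2)·⟨w, a⟩)·f(w) for all a ∈ A and w ∈ W. Let g : W → W be a bijective linear map with ⟨g x, g y⟩ = ⟨x, y⟩ for all x, y ∈ W, and let w ∈ W satisfy (g⁻¹ − 1)·w ∈ A. Then f(g⁻¹ w) = ψ((1/2)·⟨(g − 1)·w, w⟩)·f(w). -/
/-- In the lattice model, a symplectic transformation `g` with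
`(g⁻¹ − 1)w ∈ A` acts on a function satisfying the lattice-model transformation law
by the scalar `ψ((1/2)⟨(g−1)w, w⟩)`: that is, `f(g⁻¹w) = ψ((1/2)⟨(g−1)w,w⟩)·f(w)`. -/
theorem stmt_18 (F W : Type*) [Field F] (h2 : (2 : F) ≠ 0)
    [AddCommGroup W] [Module F W]
    (B : W →ₗ[F] W →ₗ[F] F) (halt : ∀ x : W, B x x = 0)
    (ψ : F → ℂˣ) (hψ : ∀ a b : F, ψ (a + b) = ψ a * ψ b)
    (A : AddSubgroup W) (f : W → ℂ)
    (hf : ∀ a ∈ A, ∀ w : W, f (a + w) = (ψ (2⁻¹ * B w a) : ℂ) * f w)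
    (g : W ≃ₗ[F] W) (hg : ∀ x y : W, B (g x) (g y) = B x y)
    (w : W) (hw : g.symm w - w ∈ A) :
    f (g.symm w) = (ψ (2⁻¹ * B (g w - w) w) : ℂ) * f w := by
  have h := hf _ hw w
  have e : B w (g.symm w - w) = B (g w - w) w := by
    have h1 := hg w (g.symm w)
    rw [LinearEquiv.apply_symm_apply] at h1
    rw [map_sub, map_sub, LinearMap.sub_apply, halt, h1]
  rw [sub_add_cancel, e] at h
  exact h
end
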